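/- Let σ > 0, 0 < ρ < 1, m > 0, K > 0, D_alt > 0, r_a > 0, λ > 0, and γ₁* > 0. Then the NOMA outage probability at UAV-1, Pr(O₁) = ∫_{√(D_alt²+λ²)}^{√(D_alt²+λ²+r_a²)} (2w/r_a²) · [∫₀^∞ ∫₀^{γ₁* w} f(r₁,r₂) dr₁ dr₂] dw, equals the convergent series ∑_{k=0}^∞ ∑_{i=0}^{k} ∑_{n=0}^{i} ∑_{j=0}^∞ α(k,i,n) · G(j,n,i−n,γ₁*) · Ḡ(λ,n+j). -/

import Mathlib

open MeasureTheory

/-- Pochhammer symbol (ascending factorial) `(m)_k = m (m+1) ⋯ (m+k-1)`. -/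
noncomputable def poch (m : ℝ) (k : ℕ) : ℝ := ∏ j ∈ Finset.range k, (m + j)

/-- Modified Bessel function of the first kind of order zero,
`I₀(y) = ∑ (y/2)^{2n} / (n!)²`. -/
noncomputable def I0 (y : ℝ) : ℝ := ∑' n : ℕ, (y / 2) ^ (2 * n) / (Nat.factorial n : ℝ) ^ 2

/-- Confluent hypergeometric function `₁F₁(m, 1; z) = ∑ (m)_n zⁿ / (n!)²`. -/
noncomputable def F11 (m z : ℝ) : ℝ := ∑' n : ℕ, poch m n * z ^ n / (Nat.factorial n : ℝ) ^ 2

/-- Series coefficient `α(k,i,n)` of the bivariate Rician shadowed joint PDF. -/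
noncomputable def alpha (σ ρ m K : ℝ) (k i n : ℕ) : ℝ :=
  (8 * Real.rpow (m * ρ / (m * ρ + K)) m / (σ ^ 6 * ρ * (1 - ρ) ^ 2)) *
  (poch m (k - i) * (K / (σ ^ 2 * ρ * (ρ * m + K))) ^ (k - i) /
    (Nat.factorial (k - i) : ℝ) ^ 2) *
  (1 / ((Nat.factorial n : ℝ) ^ 2 * (Nat.factorial (i - n) : ℝ) ^ 2 *
    (σ ^ 2 * (1 - ρ)) ^ (2 * i))) *
  ((Nat.factorial k : ℝ) / (2 * ((1 + ρ) / (σ ^ 2 * ρ * (1 - ρ))) ^ (k + 1)))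

/-- Closed-form power series of the bivariate Rician shadowed joint PDF. -/
noncomputable def fpdf (σ ρ m K r₁ r₂ : ℝ) : ℝ :=
  ∑' k : ℕ, ∑ i ∈ Finset.range (k + 1), ∑ n ∈ Finset.range (i + 1),
    alpha σ ρ m K k i n * r₁ ^ (2 * n + 1) * r₂ ^ (2 * (i - n) + 1) *
      Real.exp (-(r₁ ^ 2 + r₂ ^ 2) / (σ ^ 2 * (1 - ρ)))

/-- `G(j,l,q,γ) = (−1)^j γ^{2(l+j+1)} q! (σ²(1−ρ))^{q+1−j} / (j!·4(l+j+1))`. -/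
noncomputable def Gfun (σ ρ : ℝ) (j l q : ℕ) (γ : ℝ) : ℝ :=
  (-1 : ℝ) ^ j * γ ^ (2 * (l + j + 1)) * (Nat.factorial q : ℝ) *
    (σ ^ 2 * (1 - ρ)) ^ ((q : ℤ) + 1 - (j : ℤ)) /
    ((Nat.factorial j : ℝ) * (4 * (l + j + 1)))

/-- `Ḡ(λ,k)`, the `(2(k+1))`-th moment of the BPP distance distribution. -/
noncomputable def Gbar (Dalt ra lam : ℝ) (k : ℕ) : ℝ :=
  ((Dalt ^ 2 + lam ^ 2 + ra ^ 2) ^ (k + 2) - (Dalt ^ 2 + lam ^ 2) ^ (k + 2)) /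
    (ra ^ 2 * (k + 2))


lemma aux_poch_nonneg {m : ℝ} (hm : 0 < m) (k : ℕ) : 0 < poch m k := by
  unfold poch; exact Finset.prod_pos fun j _ => by positivity

lemma aux_poch_bound {m η : ℝ} (hm : 0 < m) (hη : 1 < η) :
    ∃ C, 0 < C ∧ ∀ p : ℕ, poch m p / (p.factorial : ℝ) ≤ C * η ^ p := by
  have h0 : 0 < η := by linarith
  have hs : Summable (fun p : ℕ => poch m p / (p.factorial : ℝ) / η ^ p) := by
    apply summable_of_ratio_test_tendsto_lt_one (l := 1 / η)
    · rw [div_lt_one h0]; exact hη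
    · refine Filter.Eventually.of_forall fun p => ?_
      have := aux_poch_nonneg hm p
      positivity
    · have h1 : Filter.Tendsto (fun n : ℕ => ((m + n) / (1 + n) : ℝ) / η) Filter.atTop (nhds (1 / η)) := by
        apply Filter.Tendsto.div_const
        simpa using tendsto_add_mul_div_add_mul_atTop_nhds m 1 1 (d := (1:ℝ)) one_ne_zero
      refine h1.congr fun p => ?_
      have hp := aux_poch_nonneg hm p
      have hp1 := aux_poch_nonneg hm (p+1)
      rw [Real.norm_of_nonneg (by positivity), Real.norm_of_nonneg (by positivity)]
      have : poch m (p+1) = poch m p * (m + p) := by unfold poch; rw [Finset.prod_range_succ]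
      rw [this, Nat.factorial_succ]
      have : (p.factorial : ℝ) ≠ 0 := by positivity
      push_cast
      field_simp
      try ring
  refine ⟨(∑' p : ℕ, poch m p / (p.factorial : ℝ) / η ^ p) + 1, ?_, fun p => ?_⟩
  · have : 0 ≤ ∑' p : ℕ, poch m p / (p.factorial : ℝ) / η ^ p :=
      tsum_nonneg fun p => by have := aux_poch_nonneg hm p; positivity
    linarith
  · have : poch m p / (p.factorial : ℝ) / η ^ p ≤ ∑' p : ℕ, poch m p / (p.factorial : ℝ) / η ^ p :=
      hs.le_tsum p fun q _ => by have := aux_poch_nonneg hm q; positivity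
    rw [← div_le_iff₀ (by positivity)]
    linarith

lemma aux_alpha_nonneg {σ ρ m K : ℝ} (hσ : 0 < σ) (hρ0 : 0 < ρ) (hρ1 : ρ < 1) (hm : 0 < m) (hK : 0 < K)
    (k i n : ℕ) : 0 ≤ alpha σ ρ m K k i n := by
  unfold alpha
  have h1 : 0 < 1 - ρ := by linarith
  have := aux_poch_nonneg hm (k - i)
  have h2 : 0 ≤ Real.rpow (m * ρ / (m * ρ + K)) m := Real.rpow_nonneg (by positivity) _
  positivity

lemma aux_summable {σ ρ m K : ℝ} (hσ : 0 < σ) (hρ0 : 0 < ρ) (hρ1 : ρ < 1) (hm : 0 < m) (hK : 0 < K) :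
    Summable (fun k : ℕ => ∑ i ∈ Finset.range (k + 1), ∑ n ∈ Finset.range (i + 1),
      alpha σ ρ m K k i n * ((n.factorial : ℝ) * (σ ^ 2 * (1 - ρ)) ^ n) *
        (((i - n).factorial : ℝ) * (σ ^ 2 * (1 - ρ)) ^ (i - n))) := by
  have h1 : 0 < 1 - ρ := by linarith
  obtain ⟨η, hη1, hη2⟩ : ∃ η : ℝ, 1 < η ∧ η * (K / (ρ * m + K)) < 1 := by
    refine ⟨(ρ * m + 2 * K) / (2 * K), ?_, ?_⟩
    · rw [lt_div_iff₀ (by positivity)]; nlinarith [mul_pos hρ0 hm]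
    · rw [div_mul_div_comm, div_lt_one (by positivity)]; nlinarith [mul_pos hρ0 hm, mul_pos (mul_pos hρ0 hm) hK]
  obtain ⟨C, hC, hb⟩ := aux_poch_bound hm hη1
  set s := σ ^ 2 * (1 - ρ) with hs
  have hs0 : 0 < s := by positivity
  set c := (1 + ρ) / (σ ^ 2 * ρ * (1 - ρ)) with hc
  have hc0 : 0 < c := by positivity
  set x := K / (σ ^ 2 * ρ * (ρ * m + K)) with hx
  have hx0 : 0 < x := by positivity
  set B := 8 * Real.rpow (m * ρ / (m * ρ + K)) m / (σ ^ 6 * ρ * (1 - ρ) ^ 2) with hB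
  have hB0 : 0 ≤ B := by
    have h2 : 0 ≤ Real.rpow (m * ρ / (m * ρ + K)) m := Real.rpow_nonneg (by positivity) _
    positivity
  set y := 2 / (s * c) + η * x / c with hy
  have hy0 : 0 ≤ y := by positivity
  have hy1 : y < 1 := by
    have e1 : y = (2 * ρ + (1 - ρ) * (η * (K / (ρ * m + K)))) / (1 + ρ) := by
      rw [hy, hs, hc, hx]; field_simp
    rw [e1, div_lt_one (by positivity)]
    nlinarith
  refine Summable.of_nonneg_of_le (fun k => ?_) (fun k => ?_)
    ((summable_geometric_of_lt_one hy0 hy1).mul_left (B * C / (2 * c)))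
  · refine Finset.sum_nonneg fun i _ => Finset.sum_nonneg fun n _ => ?_
    have := aux_alpha_nonneg hσ hρ0 hρ1 hm hK k i n
    positivity
  · rw [hy, add_pow, Finset.mul_sum]
    refine Finset.sum_le_sum fun i hi => ?_
    have hik : i ≤ k := by simpa [Nat.lt_succ_iff] using hi
    have hterm : ∀ n ∈ Finset.range (i + 1), alpha σ ρ m K k i n * ((n.factorial : ℝ) * s ^ n) *
        (((i - n).factorial : ℝ) * s ^ (i - n)) =
        (B / (2 * c) * (poch m (k-i) / ((k-i).factorial : ℝ)) * (x / c) ^ (k - i) * (1 / (s * c)) ^ i * (k.choose i : ℝ)) * (i.choose n : ℝ) := by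
      intro n hn
      have hni : n ≤ i := by simpa [Nat.lt_succ_iff] using hn
      unfold alpha
      rw [← hs, ← hc, ← hx, ← hB]
      rw [Nat.cast_choose ℝ hik, Nat.cast_choose ℝ hni]
      obtain ⟨q, rfl⟩ := Nat.exists_eq_add_of_le hni
      obtain ⟨p, rfl⟩ := Nat.exists_eq_add_of_le hik
      simp only [Nat.add_sub_cancel_left]
      have f1 : ((n.factorial : ℝ)) ≠ 0 := by positivity
      have f2 : ((q.factorial : ℝ)) ≠ 0 := by positivity
      have f3 : ((p.factorial : ℝ)) ≠ 0 := by positivity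
      have f4 : (((n+q).factorial : ℝ)) ≠ 0 := by positivity
      have f5 : s ≠ 0 := hs0.ne'
      have f6 : c ≠ 0 := hc0.ne'
      clear_value s c x B
      rw [div_pow, div_pow, mul_pow]
      field_simp
      ring
    rw [Finset.sum_congr rfl hterm, ← Finset.mul_sum]
    have : (∑ n ∈ Finset.range (i+1), (i.choose n : ℝ)) = 2 ^ i := by
      exact_mod_cast Nat.sum_range_choose i
    rw [this]
    calc _ ≤ (B / (2 * c) * (C * η ^ (k - i)) * (x / c) ^ (k - i) * (1 / (s * c)) ^ i * (k.choose i : ℝ)) * 2 ^ i := by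
            gcongr; exact hb _
      _ = _ := by
            rw [show η * x / c = η * (x / c) by ring, show 2 / (s * c) = 2 * (1 / (s * c)) by ring, mul_pow, mul_pow]
            ring

noncomputable def auxg (s : ℝ) (n : ℕ) (r : ℝ) : ℝ := r ^ (2 * n + 1) * Real.exp (-r ^ 2 / s)

noncomputable def auxH (s : ℝ) (n : ℕ) (R : ℝ) : ℝ := ∫ r in (0 : ℝ)..R, auxg s n r

lemma auxg_cont (s : ℝ) (n : ℕ) : Continuous (auxg s n) := by
  unfold auxg; fun_prop

lemma auxH_cont (s : ℝ) (n : ℕ) : Continuous (auxH s n) :=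
  intervalIntegral.continuous_primitive (fun a b => (auxg_cont s n).intervalIntegrable a b) 0

lemma auxg_nonneg (s : ℝ) (n : ℕ) {r : ℝ} (hr : 0 ≤ r) : 0 ≤ auxg s n r := by
  unfold auxg; positivity

lemma auxg_le {s : ℝ} (hs : 0 < s) (n : ℕ) {r : ℝ} (hr : 0 ≤ r) :
    auxg s n r ≤ r * ((n.factorial : ℝ) * s ^ n) := by
  unfold auxg
  have h := Real.pow_div_factorial_le_exp (x := r ^ 2 / s) (by positivity) n
  rw [div_le_iff₀ (by positivity), div_pow, div_le_iff₀ (by positivity)] at h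
  rw [neg_div, Real.exp_neg, ← div_eq_mul_inv, div_le_iff₀ (Real.exp_pos _)]
  calc r ^ (2 * n + 1) = r * (r ^ 2) ^ n := by ring
    _ ≤ r * (Real.exp (r ^ 2 / s) * n.factorial * s ^ n) := by gcongr
    _ = _ := by ring

lemma auxH_nonneg (s : ℝ) (n : ℕ) {R : ℝ} (hR : 0 ≤ R) : 0 ≤ auxH s n R :=
  intervalIntegral.integral_nonneg hR fun _ hu => auxg_nonneg s n hu.1

lemma auxH_le {s : ℝ} (hs : 0 < s) (n : ℕ) {R : ℝ} (hR : 0 ≤ R) :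
    auxH s n R ≤ R ^ 2 * ((n.factorial : ℝ) * s ^ n) := by
  have h : ‖auxH s n R‖ ≤ R * ((n.factorial : ℝ) * s ^ n) * |R - 0| := by
    refine intervalIntegral.norm_integral_le_of_norm_le_const fun x hx => ?_
    rw [Set.uIoc_of_le hR] at hx
    rw [Real.norm_of_nonneg (auxg_nonneg s n hx.1.le)]
    refine (auxg_le hs n hx.1.le).trans ?_
    have := hx.2
    gcongr
  rw [sub_zero, abs_of_nonneg hR] at h
  calc _ ≤ _ := (le_abs_self _).trans h
    _ = _ := by ring

lemma auxg_int {s : ℝ} (hs : 0 < s) (n : ℕ) : IntegrableOn (auxg s n) (Set.Ioi 0) := by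
  have h := integrableOn_rpow_mul_exp_neg_mul_sq (b := 1 / s) (by positivity) (s := ((2 * n + 1 : ℕ) : ℝ))
    (by have : (0:ℝ) ≤ ((2 * n + 1 : ℕ) : ℝ) := by positivity
        linarith)
  refine h.congr_fun (fun x hx => ?_) measurableSet_Ioi
  simp only [auxg, Real.rpow_natCast]
  congr 2; ring

lemma auxg_integral {s : ℝ} (hs : 0 < s) (n : ℕ) :
    ∫ r in Set.Ioi (0 : ℝ), auxg s n r = (n.factorial : ℝ) * s ^ (n + 1) / 2 := by
  have h := integral_rpow_mul_exp_neg_mul_rpow (p := 2) (b := 1 / s) (q := ((2 * n + 1 : ℕ) : ℝ))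
    two_pos
    (by have : (0:ℝ) ≤ ((2 * n + 1 : ℕ) : ℝ) := by positivity
        linarith) (by positivity)
  have e : ∫ r in Set.Ioi (0 : ℝ), auxg s n r = ∫ x in Set.Ioi (0 : ℝ), x ^ ((2 * n + 1 : ℕ) : ℝ) * Real.exp (-(1/s) * x ^ (2:ℝ)) := by
    refine setIntegral_congr_fun measurableSet_Ioi (fun x hx => ?_)
    simp only [auxg, Real.rpow_natCast, Real.rpow_two]
    congr 2; ring
  rw [e, h]
  have e1 : ((((2 * n + 1 : ℕ) : ℝ)) + 1) / 2 = (n : ℝ) + 1 := by push_cast; ring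
  have e2 : -((((2 * n + 1 : ℕ) : ℝ)) + 1) / 2 = -((n + 1 : ℕ) : ℝ) := by push_cast; ring
  rw [e1, e2, Real.Gamma_nat_eq_factorial, Real.rpow_neg (by positivity), Real.rpow_natCast]
  rw [one_div, inv_pow, inv_inv]; ring

lemma auxg_hasSum (s : ℝ) (n : ℕ) (r : ℝ) :
    HasSum (fun j : ℕ => (-1) ^ j / (s ^ j * (j.factorial : ℝ)) * r ^ (2 * (n + j) + 1)) (auxg s n r) := by
  have h := NormedSpace.expSeries_div_hasSum_exp (-r ^ 2 / s)
  rw [← Real.exp_eq_exp_ℝ] at h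
  have h2 := h.mul_left (r ^ (2 * n + 1))
  refine h2.congr_fun ?_
  intro j
  rw [neg_div, neg_pow (r ^ 2 / s), div_pow]
  ring

lemma aux_absterm {s : ℝ} (hs : 0 < s) (n j : ℕ) {r R : ℝ} (hr : 0 ≤ r) (hR : r ≤ R) (e : ℕ):
    ‖(-1) ^ j / (s ^ j * (j.factorial : ℝ)) * r ^ (2 * (n + j) + e)‖ ≤ R ^ (2 * n + e) * ((R ^ 2 / s) ^ j / (j.factorial : ℝ)) := by
  rw [norm_mul, norm_div, norm_pow, norm_neg, norm_one, one_pow, Real.norm_of_nonneg (by positivity),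
    Real.norm_of_nonneg (by positivity)]
  calc _ ≤ 1 / (s ^ j * (j.factorial : ℝ)) * R ^ (2 * (n + j) + e) := by gcongr
    _ = _ := by rw [div_pow]; field_simp; ring

lemma auxH_hasSum {s : ℝ} (hs : 0 < s) (n : ℕ) {R : ℝ} (hR : 0 ≤ R) :
    HasSum (fun j : ℕ => (-1) ^ j / (s ^ j * (j.factorial : ℝ)) * R ^ (2 * (n + j) + 2) / (2 * (n + j + 1)))
      (auxH s n R) := by
  have h := intervalIntegral.hasSum_integral_of_dominated_convergence (μ := volume) (a := 0) (b := R)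
    (F := fun (j : ℕ) r => (-1) ^ j / (s ^ j * (j.factorial : ℝ)) * r ^ (2 * (n + j) + 1))
    (f := auxg s n) (fun j _ => R ^ (2 * n + 1) * ((R ^ 2 / s) ^ j / (j.factorial : ℝ)))
    (fun j => by apply Continuous.aestronglyMeasurable; fun_prop)
    (fun j => Filter.Eventually.of_forall fun r hr => by
      rw [Set.uIoc_of_le hR] at hr
      exact aux_absterm hs n j hr.1.le hr.2 1)
    (Filter.Eventually.of_forall fun r hr => (Real.summable_pow_div_factorial _).mul_left _)
    (by simp)
    (Filter.Eventually.of_forall fun r hr => auxg_hasSum s n r)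
  unfold auxH
  refine h.congr_fun ?_
  intro j
  rw [intervalIntegral.integral_const_mul, integral_pow]
  push_cast
  have : ((n:ℝ) + j + 1) ≠ 0 := by positivity
  have : (2 * ((n:ℝ) + j) + 1 + 1) ≠ 0 := by positivity
  field_simp
  ring

lemma aux_step4 {s ra γ A B : ℝ} (hs : 0 < s) (hγ : 0 < γ) (hra : 0 < ra) (hA : 0 ≤ A) (hAB : A ≤ B) (n : ℕ) :
    HasSum (fun j : ℕ => (-1) ^ j / (s ^ j * (j.factorial : ℝ)) * γ ^ (2 * (n + j + 1)) / (2 * (n + j + 1)) *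
      ((B ^ 2) ^ (n + j + 2) - (A ^ 2) ^ (n + j + 2)) / (ra ^ 2 * (n + j + 2)))
      (∫ w in A..B, 2 * w / ra ^ 2 * auxH s n (γ * w)) := by
  have h := intervalIntegral.hasSum_integral_of_dominated_convergence (μ := volume) (a := A) (b := B)
    (F := fun (j : ℕ) w => 2 * w / ra ^ 2 * ((-1) ^ j / (s ^ j * (j.factorial : ℝ)) * (γ * w) ^ (2 * (n + j) + 2) / (2 * (n + j + 1))))
    (f := fun w => 2 * w / ra ^ 2 * auxH s n (γ * w))
    (fun j _ => 2 * B / ra ^ 2 * ((γ * B) ^ (2 * n + 2) * (((γ * B) ^ 2 / s) ^ j / (j.factorial : ℝ))))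
    (fun j => by apply Continuous.aestronglyMeasurable; fun_prop)
    (fun j => Filter.Eventually.of_forall fun r hr => by
      rw [Set.uIoc_of_le hAB] at hr
      have hr0 : 0 ≤ r := hA.trans hr.1.le
      have hrB := hr.2
      have hB0 := hA.trans hAB
      have h1 := aux_absterm hs n j (r := γ * r) (R := γ * B) (by positivity) (by gcongr) 2
      rw [norm_mul, Real.norm_of_nonneg (by positivity), norm_div,
        Real.norm_of_nonneg (r := 2 * ((n:ℝ) + j + 1)) (by positivity)]
      gcongr
      refine (div_le_self (norm_nonneg _) ?_).trans h1
      have : (0:ℝ) ≤ n := by positivity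
      have : (0:ℝ) ≤ j := by positivity
      linarith)
    (Filter.Eventually.of_forall fun r hr => ((Real.summable_pow_div_factorial _).mul_left _).mul_left _)
    (by simp)
    (Filter.Eventually.of_forall fun r hr => by
      rw [Set.uIoc_of_le hAB] at hr
      have hr0 : 0 ≤ r := hA.trans hr.1.le
      exact (auxH_hasSum hs n (by positivity)).mul_left _)
  refine h.congr_fun ?_
  intro j
  have : ∀ w : ℝ, 2 * w / ra ^ 2 * ((-1) ^ j / (s ^ j * (j.factorial : ℝ)) * (γ * w) ^ (2 * (n + j) + 2) / (2 * (n + j + 1)))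
    = (2 / ra ^ 2 * ((-1) ^ j / (s ^ j * (j.factorial : ℝ)) * γ ^ (2 * (n + j) + 2) / (2 * (n + j + 1)))) * w ^ (2 * (n + j) + 3) := by
    intro w; rw [mul_pow]; ring
  simp_rw [this]
  rw [intervalIntegral.integral_const_mul, integral_pow]
  have h1 : ((n:ℝ) + j + 1) ≠ 0 := by positivity
  have h2 : ((n:ℝ) + j + 2) ≠ 0 := by positivity
  rw [← pow_mul, ← pow_mul, show 2 * (n + j) + 3 + 1 = 2 * (n + j + 2) by ring, show 2 * (n + j) + 2 = 2 * (n + j + 1) by ring]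
  have h3 : (((2 * (n + j) + 3 : ℕ) : ℝ) + 1) = 2 * ((n : ℝ) + j + 2) := by push_cast; ring
  rw [h3]
  generalize B ^ (2 * (n + j + 2)) - A ^ (2 * (n + j + 2)) = X
  field_simp

/-- Weighted double sums. -/
noncomputable def auxS (a : ℕ → ℕ → ℕ → ℝ) (u v : ℕ → ℝ) (k : ℕ) : ℝ :=
  ∑ i ∈ Finset.range (k + 1), ∑ n ∈ Finset.range (i + 1), a k i n * u n * v (i - n)

lemma auxS_nonneg {a : ℕ → ℕ → ℕ → ℝ} (ha : ∀ k i n, 0 ≤ a k i n) {u v : ℕ → ℝ}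
    (hu : ∀ n, 0 ≤ u n) (hv : ∀ n, 0 ≤ v n) (k : ℕ) : 0 ≤ auxS a u v k :=
  Finset.sum_nonneg fun i _ => Finset.sum_nonneg fun n _ =>
    mul_nonneg (mul_nonneg (ha k i n) (hu n)) (hv _)

lemma auxS_le {a : ℕ → ℕ → ℕ → ℝ} (ha : ∀ k i n, 0 ≤ a k i n) {u v u' v' : ℕ → ℝ} {c d : ℝ}
    (hu : ∀ n, 0 ≤ u n) (hv : ∀ n, 0 ≤ v n) (huu : ∀ n, u n ≤ c * u' n) (hvv : ∀ n, v n ≤ d * v' n) (k : ℕ) :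
    auxS a u v k ≤ c * d * auxS a u' v' k := by
  unfold auxS
  simp_rw [Finset.mul_sum]
  refine Finset.sum_le_sum fun i _ => Finset.sum_le_sum fun n _ => ?_
  calc a k i n * u n * v (i - n) ≤ a k i n * (c * u' n) * (d * v' (i - n)) := by
        have := ha k i n
        have := hv (i - n)
        have := (hu n).trans (huu n)
        have := huu n
        have := hvv (i - n)
        gcongr
    _ = _ := by ring

lemma auxS_cont {a : ℕ → ℕ → ℕ → ℝ} {u v : ℕ → ℝ → ℝ} (hu : ∀ n, Continuous (u n)) (hv : ∀ n, Continuous (v n))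
    (k : ℕ) : Continuous (fun r => auxS a (fun n => u n r) (fun n => v n r) k) := by
  unfold auxS
  fun_prop

section
variable {a : ℕ → ℕ → ℕ → ℝ} {s : ℝ}

lemma aux_step1 (ha : ∀ k i n, 0 ≤ a k i n) (hs : 0 < s)
    (hM : Summable (auxS a (fun n => (n.factorial : ℝ) * s ^ n) (fun n => (n.factorial : ℝ) * s ^ n)))
    {R r₂ : ℝ} (hR : 0 ≤ R) (hr₂ : 0 ≤ r₂) :
    HasSum (auxS a (fun n => auxH s n R) (fun q => auxg s q r₂))
      (∫ r₁ in (0:ℝ)..R, ∑' k, auxS a (fun n => auxg s n r₁) (fun q => auxg s q r₂) k) := by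
  have hb : ∀ k, ∀ r, r ∈ Set.uIoc 0 R → ‖auxS a (fun n => auxg s n r) (fun q => auxg s q r₂) k‖ ≤
      R * r₂ * auxS a (fun n => (n.factorial : ℝ) * s ^ n) (fun n => (n.factorial : ℝ) * s ^ n) k := by
    intro k r hr
    rw [Set.uIoc_of_le hR] at hr
    rw [Real.norm_of_nonneg (auxS_nonneg ha (fun n => auxg_nonneg s n hr.1.le) (fun n => auxg_nonneg s n hr₂) k)]
    refine auxS_le ha (fun n => auxg_nonneg s n hr.1.le) (fun n => auxg_nonneg s n hr₂)
      (fun n => (auxg_le hs n hr.1.le).trans ?_) (fun n => auxg_le hs n hr₂) k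
    have := hr.2
    gcongr
  have h := intervalIntegral.hasSum_integral_of_dominated_convergence (μ := volume) (a := 0) (b := R)
    (F := fun (k : ℕ) r => auxS a (fun n => auxg s n r) (fun q => auxg s q r₂) k)
    (f := fun r => ∑' k, auxS a (fun n => auxg s n r) (fun q => auxg s q r₂) k)
    (fun k _ => R * r₂ * auxS a (fun n => (n.factorial : ℝ) * s ^ n) (fun n => (n.factorial : ℝ) * s ^ n) k)
    (fun k => (auxS_cont (fun n => auxg_cont s n) (fun n => continuous_const) k).aestronglyMeasurable)
    (fun k => Filter.Eventually.of_forall fun r hr => hb k r hr)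
    (Filter.Eventually.of_forall fun r hr => hM.mul_left _)
    (by simp)
    (Filter.Eventually.of_forall fun r hr =>
      (Summable.of_norm_bounded (hM.mul_left (R * r₂)) (fun k => hb k r hr)).hasSum)
  refine h.congr_fun fun k => ?_
  unfold auxS
  have hc := auxg_cont s
  rw [intervalIntegral.integral_finsetSum fun i _ => (by apply Continuous.intervalIntegrable; fun_prop)]
  refine Finset.sum_congr rfl fun i _ => ?_
  rw [intervalIntegral.integral_finsetSum fun i _ => (by apply Continuous.intervalIntegrable; fun_prop)]
  refine Finset.sum_congr rfl fun n _ => ?_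
  rw [intervalIntegral.integral_mul_const, intervalIntegral.integral_const_mul]
  rfl

lemma aux_step2 (ha : ∀ k i n, 0 ≤ a k i n) (hs : 0 < s)
    (hM : Summable (auxS a (fun n => (n.factorial : ℝ) * s ^ n) (fun n => (n.factorial : ℝ) * s ^ n)))
    {R : ℝ} (hR : 0 ≤ R) :
    HasSum (auxS a (fun n => auxH s n R) (fun q => (q.factorial : ℝ) * s ^ (q + 1) / 2))
      (∫ r₂ in Set.Ioi (0:ℝ), ∫ r₁ in (0:ℝ)..R, ∑' k, auxS a (fun n => auxg s n r₁) (fun q => auxg s q r₂) k) := by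
  have hint : ∀ k i n, IntegrableOn (fun r => a k i n * auxH s n R * auxg s (i - n) r) (Set.Ioi 0) :=
    fun k i n => (auxg_int hs (i - n)).const_mul _
  have hint' : ∀ k, IntegrableOn (fun r => auxS a (fun n => auxH s n R) (fun q => auxg s q r) k) (Set.Ioi 0) :=
    fun k => integrable_finsetSum _ fun i _ => integrable_finsetSum _ fun n _ => hint k i n
  have hval : ∀ k, ∫ r in Set.Ioi (0:ℝ), auxS a (fun n => auxH s n R) (fun q => auxg s q r) k =
      auxS a (fun n => auxH s n R) (fun q => (q.factorial : ℝ) * s ^ (q + 1) / 2) k := by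
    intro k
    unfold auxS
    rw [integral_finsetSum _ fun i _ => integrable_finsetSum _ fun n _ => hint k i n]
    refine Finset.sum_congr rfl fun i _ => ?_
    rw [integral_finsetSum _ fun n _ => hint k i n]
    refine Finset.sum_congr rfl fun n _ => ?_
    rw [integral_const_mul, auxg_integral hs]
  have h := hasSum_integral_of_summable_integral_norm (μ := volume.restrict (Set.Ioi (0:ℝ)))
    (F := fun k r => auxS a (fun n => auxH s n R) (fun q => auxg s q r) k) hint' (by
      have e : ∀ k, ∫ r in Set.Ioi (0:ℝ), ‖auxS a (fun n => auxH s n R) (fun q => auxg s q r) k‖ =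
        auxS a (fun n => auxH s n R) (fun q => (q.factorial : ℝ) * s ^ (q + 1) / 2) k := by
        intro k
        rw [← hval k]
        refine setIntegral_congr_fun measurableSet_Ioi fun r hr => ?_
        exact Real.norm_of_nonneg (auxS_nonneg ha (fun n => auxH_nonneg s n hR) (fun n => auxg_nonneg s n (le_of_lt hr)) k)
      simp_rw [e]
      refine Summable.of_nonneg_of_le (fun k => auxS_nonneg ha (fun n => auxH_nonneg s n hR) (fun n => by positivity) k)
        (fun k => auxS_le ha (fun n => auxH_nonneg s n hR) (fun n => by positivity)
          (fun n => auxH_le hs n hR) (fun n => (le_of_eq (by ring) : _ ≤ s / 2 * ((n.factorial : ℝ) * s ^ n))) k) (hM.mul_left _))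
  simp_rw [hval] at h
  convert! h using 1
  refine setIntegral_congr_fun measurableSet_Ioi fun r hr => ?_
  exact (aux_step1 ha hs hM hR (le_of_lt hr)).tsum_eq.symm

lemma aux_step3 (ha : ∀ k i n, 0 ≤ a k i n) (hs : 0 < s)
    (hM : Summable (auxS a (fun n => (n.factorial : ℝ) * s ^ n) (fun n => (n.factorial : ℝ) * s ^ n)))
    {A B γ ra : ℝ} (hA : 0 ≤ A) (hAB : A ≤ B) (hγ : 0 < γ) (hra : 0 < ra) :
    HasSum (auxS a (fun n => ∫ w in A..B, 2 * w / ra ^ 2 * auxH s n (γ * w)) (fun q => (q.factorial : ℝ) * s ^ (q + 1) / 2))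
      (∫ w in A..B, 2 * w / ra ^ 2 * ∫ r₂ in Set.Ioi (0:ℝ), ∫ r₁ in (0:ℝ)..(γ * w),
        ∑' k, auxS a (fun n => auxg s n r₁) (fun q => auxg s q r₂) k) := by
  have hc := fun n => auxH_cont s n
  have h := intervalIntegral.hasSum_integral_of_dominated_convergence (μ := volume) (a := A) (b := B)
    (F := fun (k : ℕ) w => 2 * w / ra ^ 2 * auxS a (fun n => auxH s n (γ * w)) (fun q => (q.factorial : ℝ) * s ^ (q + 1) / 2) k)
    (f := fun w => 2 * w / ra ^ 2 * ∫ r₂ in Set.Ioi (0:ℝ), ∫ r₁ in (0:ℝ)..(γ * w),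
        ∑' k, auxS a (fun n => auxg s n r₁) (fun q => auxg s q r₂) k)
    (fun k _ => 2 * B / ra ^ 2 * ((γ * B) ^ 2 * (s / 2) * auxS a (fun n => (n.factorial : ℝ) * s ^ n) (fun n => (n.factorial : ℝ) * s ^ n) k))
    (fun k => by
      apply Continuous.aestronglyMeasurable
      have := auxS_cont (a := a) (u := fun n w => auxH s n (γ * w)) (v := fun q _ => (q.factorial : ℝ) * s ^ (q + 1) / 2)
        (fun n => by fun_prop) (fun n => continuous_const) k
      fun_prop)
    (fun k => Filter.Eventually.of_forall fun r hr => by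
      rw [Set.uIoc_of_le hAB] at hr
      have hr0 : 0 ≤ r := hA.trans hr.1.le
      have hrB := hr.2
      have hB0 := hA.trans hAB
      have hn := auxS_nonneg ha (u := fun n => auxH s n (γ * r)) (v := fun q => (q.factorial : ℝ) * s ^ (q + 1) / 2)
        (fun n => auxH_nonneg s n (by positivity)) (fun n => by positivity) k
      rw [Real.norm_of_nonneg (by positivity)]
      gcongr
      refine auxS_le ha (fun n => auxH_nonneg s n (by positivity)) (fun n => by positivity)
        (fun n => (auxH_le hs n (by positivity)).trans ?_) (fun n => le_of_eq (by ring)) k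
      gcongr)
    (Filter.Eventually.of_forall fun r hr => (hM.mul_left _).mul_left _)
    (by simp)
    (Filter.Eventually.of_forall fun r hr => by
      rw [Set.uIoc_of_le hAB] at hr
      have hr0 : 0 ≤ r := hA.trans hr.1.le
      exact (aux_step2 ha hs hM (by positivity)).mul_left _)
  refine h.congr_fun fun k => ?_
  unfold auxS
  simp_rw [Finset.mul_sum]
  rw [intervalIntegral.integral_finsetSum fun i _ => (by apply Continuous.intervalIntegrable; fun_prop)]
  refine Finset.sum_congr rfl fun i _ => ?_
  rw [intervalIntegral.integral_finsetSum fun i _ => (by apply Continuous.intervalIntegrable; fun_prop)]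
  refine Finset.sum_congr rfl fun n _ => ?_
  rw [← intervalIntegral.integral_const_mul, ← intervalIntegral.integral_mul_const]
  congr 1; ext w; ring
end

theorem noma_outage_uav1 (σ ρ m K Dalt ra lam γ₁ : ℝ)
    (hσ : 0 < σ) (hρ0 : 0 < ρ) (hρ1 : ρ < 1) (hm : 0 < m) (hK : 0 < K)
    (hD : 0 < Dalt) (hra : 0 < ra) (hlam : 0 < lam) (hγ₁ : 0 < γ₁) :
    Summable (fun k : ℕ => ∑ i ∈ Finset.range (k + 1), ∑ n ∈ Finset.range (i + 1),
      ∑' j : ℕ, alpha σ ρ m K k i n * Gfun σ ρ j n (i - n) γ₁ * Gbar Dalt ra lam (n + j)) ∧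
    (∫ w in Real.sqrt (Dalt ^ 2 + lam ^ 2)..Real.sqrt (Dalt ^ 2 + lam ^ 2 + ra ^ 2),
        (2 * w / ra ^ 2) *
          ∫ r₂ in Set.Ioi (0 : ℝ), ∫ r₁ in (0 : ℝ)..(γ₁ * w), fpdf σ ρ m K r₁ r₂) =
      ∑' k : ℕ, ∑ i ∈ Finset.range (k + 1), ∑ n ∈ Finset.range (i + 1),
        ∑' j : ℕ, alpha σ ρ m K k i n * Gfun σ ρ j n (i - n) γ₁ *
          Gbar Dalt ra lam (n + j) := by

  have h1 : 0 < 1 - ρ := by linarith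
  have hs : 0 < σ ^ 2 * (1 - ρ) := by positivity
  have hP : 0 ≤ Dalt ^ 2 + lam ^ 2 := by positivity
  have hQ : 0 ≤ Dalt ^ 2 + lam ^ 2 + ra ^ 2 := by positivity
  have hAB : Real.sqrt (Dalt ^ 2 + lam ^ 2) ≤ Real.sqrt (Dalt ^ 2 + lam ^ 2 + ra ^ 2) :=
    Real.sqrt_le_sqrt (by linarith [sq_nonneg ra])
  have h := aux_step3 (a := alpha σ ρ m K) (fun k i n => aux_alpha_nonneg hσ hρ0 hρ1 hm hK k i n) hs
    (aux_summable hσ hρ0 hρ1 hm hK) (Real.sqrt_nonneg _) hAB hγ₁ hra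
  have hf : ∀ r₁ r₂, ∑' k, auxS (alpha σ ρ m K) (fun n => auxg (σ ^ 2 * (1 - ρ)) n r₁)
      (fun q => auxg (σ ^ 2 * (1 - ρ)) q r₂) k = fpdf σ ρ m K r₁ r₂ := by
    intro r₁ r₂
    unfold fpdf auxS auxg
    refine tsum_congr fun k => Finset.sum_congr rfl fun i _ => Finset.sum_congr rfl fun n _ => ?_
    rw [neg_add, add_div, Real.exp_add]
    ring
  simp_rw [hf] at h
  have h' := h.congr_fun (g := fun k : ℕ => ∑ i ∈ Finset.range (k + 1), ∑ n ∈ Finset.range (i + 1),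
      ∑' j : ℕ, alpha σ ρ m K k i n * Gfun σ ρ j n (i - n) γ₁ * Gbar Dalt ra lam (n + j)) (fun k => by
    unfold auxS
    refine Finset.sum_congr rfl fun i _ => Finset.sum_congr rfl fun n _ => ?_
    have h4 := ((aux_step4 hs hγ₁ hra (Real.sqrt_nonneg _) hAB n).mul_left (alpha σ ρ m K k i n)).mul_right
      (((i - n).factorial : ℝ) * (σ ^ 2 * (1 - ρ)) ^ ((i - n) + 1) / 2)
    rw [← h4.tsum_eq]
    refine tsum_congr fun j => ?_
    unfold Gfun Gbar
    rw [Real.sq_sqrt hP, Real.sq_sqrt hQ, zpow_sub₀ hs.ne', zpow_natCast,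
      show (((i - n : ℕ) : ℤ) + 1) = ((i - n + 1 : ℕ) : ℤ) by push_cast; rfl, zpow_natCast]
    generalize (Dalt ^ 2 + lam ^ 2 + ra ^ 2) ^ (n + j + 2) - (Dalt ^ 2 + lam ^ 2) ^ (n + j + 2) = X
    generalize alpha σ ρ m K k i n = Y
    generalize σ ^ 2 * (1 - ρ) = s at *
    have e1 : ((n:ℝ) + j + 1) ≠ 0 := by positivity
    have e2 : ((n:ℝ) + j + 2) ≠ 0 := by positivity
    push_cast
    field_simp
    try norm_num
    try ring)
  exact ⟨h'.summable, h'.tsum_eq.symm⟩
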